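/- Let A be in the open unit ball B of L(K,H) and define η(Z) = (I - AA*)^{-1/2}(Z + A)(I + A*Z)^{-1}(I - A*A)^{1/2} for Z in B. Then η maps B into B and is invertible with inverse η^{-1}(Z) = (I - AA*)^{-1/2}(Z - A)(I - A*Z)^{-1}(I - A*A)^{1/2}. -/

import Mathlib

open ContinuousLinearMap

/-- The Möbius-type transformation
`η(Z) = (I - AA*)^{-1/2} (Z + A) (I + A*Z)^{-1} (I - A*A)^{1/2}`, where
`P = (I - AA*)^{-1/2}` and `S = (I - A*A)^{1/2}` are given. -/
noncomputable def mobiusEta {H K : Type*}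
    [NormedAddCommGroup H] [InnerProductSpace ℂ H] [CompleteSpace H]
    [NormedAddCommGroup K] [InnerProductSpace ℂ K] [CompleteSpace K]
    (A : K →L[ℂ] H) (P : H →L[ℂ] H) (S : K →L[ℂ] K) (Z : K →L[ℂ] H) : K →L[ℂ] H :=
  P.comp ((Z + A).comp ((Ring.inverse ((1 : K →L[ℂ] K) + (adjoint A).comp Z)).comp S))

/-- The candidate inverse
`η⁻¹(Z) = (I - AA*)^{-1/2} (Z - A) (I - A*Z)^{-1} (I - A*A)^{1/2}`. -/
noncomputable def mobiusEtaInv {H K : Type*}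
    [NormedAddCommGroup H] [InnerProductSpace ℂ H] [CompleteSpace H]
    [NormedAddCommGroup K] [InnerProductSpace ℂ K] [CompleteSpace K]
    (A : K →L[ℂ] H) (P : H →L[ℂ] H) (S : K →L[ℂ] K) (Z : K →L[ℂ] H) : K →L[ℂ] H :=
  P.comp ((Z - A).comp ((Ring.inverse ((1 : K →L[ℂ] K) - (adjoint A).comp Z)).comp S))

section helpers

theorem mob_inverse_eq {R : Type*} [Ring R] {a b : R} (h1 : a * b = 1) (h2 : b * a = 1) :
    Ring.inverse a = b := by
  have := Ring.inverse_unit (⟨a, b, h1, h2⟩ : Rˣ)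
  simpa using this

variable {H K : Type*} [NormedAddCommGroup H] [InnerProductSpace ℂ H] [CompleteSpace H]
    [NormedAddCommGroup K] [InnerProductSpace ℂ K] [CompleteSpace K]

theorem mob_sylvester (X : K →L[ℂ] H) (P : H →L[ℂ] H) (hP : P.IsPositive)
    (S : K →L[ℂ] K) (hS : S.IsPositive) (h : P ∘L X ∘L S = -X) : X = 0 := by
  set N : K →L[ℂ] K := adjoint X ∘L P ∘L X with hN
  have hNpos : N.IsPositive := by
    simpa using hP.adjoint_conj X
  have hNS : N * S = -(adjoint X ∘L X) := by
    ext x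
    have := congrArg (fun f : K →L[ℂ] H => adjoint X (f x)) h
    simpa [hN] using this
  have hsa : S * N = -(adjoint X ∘L X) := by
    have h2 := congrArg star hNS
    rw [star_mul, hS.isSelfAdjoint.star_eq, hNpos.isSelfAdjoint.star_eq] at h2
    rw [h2, star_neg, ContinuousLinearMap.star_eq_adjoint, adjoint_comp, adjoint_adjoint]
  have hc : Commute N S := by rw [Commute, SemiconjBy, hNS, hsa]
  have h0 : 0 ≤ N * S := hc.mul_nonneg
    ((ContinuousLinearMap.nonneg_iff_isPositive N).2 hNpos)
    ((ContinuousLinearMap.nonneg_iff_isPositive S).2 hS)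
  rw [hNS, ContinuousLinearMap.nonneg_iff_isPositive] at h0
  ext x
  have h1 := h0.re_inner_nonneg_left x
  simp only [neg_apply, comp_apply, inner_neg_left, adjoint_inner_left,
    inner_self_eq_norm_sq_to_K] at h1
  norm_cast at h1
  have : ‖X x‖ = 0 := by nlinarith [norm_nonneg (X x)]
  simpa using this

theorem mob_main (A : K →L[ℂ] H) (hA : ‖A‖ < 1)
    (P : H →L[ℂ] H) (hP : P.IsPositive)
    (hP₁ : (P * P) * ((1 : H →L[ℂ] H) - A.comp (adjoint A)) = 1)
    (S : K →L[ℂ] K) (hS : S.IsPositive)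
    (hSsq : S * S = (1 : K →L[ℂ] K) - (adjoint A).comp A)
    (Z : K →L[ℂ] H) (hZ : ‖Z‖ < 1) :
      ‖mobiusEta A P S Z‖ < 1 ∧ mobiusEtaInv A P S (mobiusEta A P S Z) = Z := by
  have hAs : ‖adjoint A‖ < 1 := by simpa using hA
  have hlt : ∀ Y : K →L[ℂ] H, ‖Y‖ < 1 → ‖(adjoint A).comp Y‖ < 1 := fun Y hY =>
    (opNorm_comp_le _ _).trans_lt (by nlinarith [norm_nonneg (adjoint A), norm_nonneg Y])
  -- the inverse of `1 + A*Z`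
  obtain ⟨R, hR1, hR2⟩ : ∃ R : K →L[ℂ] K, (1 + (adjoint A).comp Z) * R = 1 ∧
      R * (1 + (adjoint A).comp Z) = 1 := by
    have hu : IsUnit (1 - (-((adjoint A).comp Z))) :=
      isUnit_one_sub_of_norm_lt_one (by rw [norm_neg]; exact hlt Z hZ)
    rw [sub_neg_eq_add] at hu
    obtain ⟨u, hu⟩ := hu
    exact ⟨↑u⁻¹, by rw [← hu]; simp, by rw [← hu]; simp⟩
  -- the inverse of `S`
  obtain ⟨T, hT1, hT2⟩ : ∃ T : K →L[ℂ] K, S * T = 1 ∧ T * S = 1 := by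
    have hu : IsUnit (1 - ((adjoint A).comp A)) :=
      isUnit_one_sub_of_norm_lt_one (hlt A hA)
    rw [← hSsq] at hu
    have hu' : IsUnit S := by
      have := (isUnit_pow_iff (n := 2) two_ne_zero (a := S)).1 (by rwa [pow_two])
      exact this
    obtain ⟨u, hu⟩ := hu'
    exact ⟨↑u⁻¹, by rw [← hu]; simp, by rw [← hu]; simp⟩
  have vP : ∀ h : H, P (P (h - A (adjoint A h))) = h := fun h => by
    simpa using DFunLike.congr_fun hP₁ h
  have vS : ∀ k : K, S (S k) = k - adjoint A (A k) := fun k => by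
    simpa using DFunLike.congr_fun hSsq k
  have vR1 : ∀ k : K, R k + adjoint A (Z (R k)) = k := fun k => by
    simpa using DFunLike.congr_fun hR1 k
  have vT1 : ∀ k : K, S (T k) = k := fun k => by
    simpa using DFunLike.congr_fun hT1 k
  have vT2 : ∀ k : K, T (S k) = k := fun k => by
    simpa using DFunLike.congr_fun hT2 k
  -- intertwining
  have hX : P ∘L A ∘L S = A := by
    rw [← sub_eq_zero]
    apply mob_sylvester _ P hP S hS
    ext k
    have h1 := vP (A k)
    have h2 : A k - A (adjoint A (A k)) = A (S (S k)) := by rw [vS, map_sub]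
    rw [h2] at h1
    simp [h1]
  have vX : ∀ k, P (A (S k)) = A k := fun k => DFunLike.congr_fun hX k
  have vX' : ∀ h, S (adjoint A (P h)) = adjoint A h := fun h => by
    have h1 := congrArg adjoint hX
    rw [adjoint_comp, adjoint_comp, hP.isSelfAdjoint.adjoint_eq,
      hS.isSelfAdjoint.adjoint_eq] at h1
    exact DFunLike.congr_fun h1 h
  have hRi : Ring.inverse (1 + (adjoint A).comp Z) = R := mob_inverse_eq hR1 hR2
  set W := mobiusEta A P S Z with hW
  have vW : ∀ k, W k = P (Z (R (S k)) + A (R (S k))) := fun k => by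
    rw [hW, mobiusEta, hRi]; simp
  have sP : ∀ a b : H, inner ℂ (P a) b = inner ℂ a (P b) := fun a b => by
    conv_lhs => rw [← hP.isSelfAdjoint.adjoint_eq, adjoint_inner_left]
  have sS : ∀ a b : K, inner ℂ (S a) b = inner ℂ a (S b) := fun a b => by
    conv_lhs => rw [← hS.isSelfAdjoint.adjoint_eq, adjoint_inner_left]
  constructor
  · -- norm identity
    have key : ∀ k, ‖k‖ ^ 2 - ‖W k‖ ^ 2 = ‖R (S k)‖ ^ 2 - ‖Z (R (S k))‖ ^ 2 := fun k => by
      set y := R (S k) with hy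
      set u := Z y with hu
      set v := T k with hv
      have hk : S v = k := vT1 k
      have h1 : y + adjoint A u = S k := vR1 (S k)
      have h3 : S k = v - adjoint A (A v) := by rw [← hk, vS]
      have h4 : P (P (u + A y)) = u + A v := by
        rw [← vP (u + A v)]
        congr 2
        have : A v - A (adjoint A (A v)) = A y + A (adjoint A u) := by
          rw [← map_sub, ← h3, ← h1, map_add]
        simp only [map_add]
        rw [← sub_eq_zero] at this ⊢
        rw [← neg_eq_zero, ← this]
        abel
      have e1 : inner ℂ (W k) (W k) = inner ℂ (u + A v) (u + A y) := by
        rw [vW, ← sP, h4]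
      have e2 : inner ℂ k k = inner ℂ v (y + adjoint A u) := by
        rw [h1, ← sS, hk]
      have hy2 : y = v - adjoint A (A v) - adjoint A u := by
        rw [← h3, ← h1]; abel
      have e3 : inner ℂ k k - inner ℂ (W k) (W k) = inner ℂ y y - inner ℂ u u := by
        rw [e1, e2]
        have : inner ℂ y y = inner ℂ (v - adjoint A (A v) - adjoint A u) y := by rw [← hy2]
        rw [this]
        simp only [inner_add_left, inner_add_right, inner_sub_left, adjoint_inner_left,
          adjoint_inner_right]
        ring
      simp only [inner_self_eq_norm_sq_to_K] at e3
      exact_mod_cast e3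
    set M := ‖T * (1 + (adjoint A).comp Z)‖ with hM
    have hMk : ∀ k, ‖k‖ ≤ M * ‖R (S k)‖ := fun k => by
      have h1 := (T * (1 + (adjoint A).comp Z)).le_opNorm (R (S k))
      have h2 : (T * (1 + (adjoint A).comp Z)) (R (S k)) = k := by
        have : T (R (S k) + adjoint A (Z (R (S k)))) = k := by rw [vR1, vT2]
        simpa using this
      rwa [h2] at h1
    have hM0 : 0 ≤ M := norm_nonneg _
    set c : ℝ := (1 - ‖Z‖ ^ 2) / (M ^ 2 + 1) with hc
    have hZ2 : 0 < 1 - ‖Z‖ ^ 2 := by nlinarith [norm_nonneg Z]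
    have hcpos : 0 < c := by positivity
    have hc1 : c ≤ 1 := by
      rw [hc, div_le_one (by positivity)]
      nlinarith [sq_nonneg ‖Z‖, sq_nonneg M]
    have hcM : c * (M ^ 2 + 1) = 1 - ‖Z‖ ^ 2 := by rw [hc]; field_simp
    have hb : ‖W‖ ≤ Real.sqrt (1 - c) := by
      refine opNorm_le_bound _ (Real.sqrt_nonneg _) fun k => ?_
      refine (pow_le_pow_iff_left₀ (norm_nonneg _) (by positivity) two_ne_zero).1 ?_
      rw [mul_pow, Real.sq_sqrt (by linarith)]
      have h1 := key k
      have h2 : ‖Z (R (S k))‖ ^ 2 ≤ ‖Z‖ ^ 2 * ‖R (S k)‖ ^ 2 := by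
        rw [← mul_pow]; gcongr; exact Z.le_opNorm _
      have h3 : ‖k‖ ^ 2 ≤ M ^ 2 * ‖R (S k)‖ ^ 2 := by
        rw [← mul_pow]; gcongr; exact hMk k
      have h4 : c * ‖k‖ ^ 2 ≤ c * (M ^ 2 + 1) * ‖R (S k)‖ ^ 2 := by
        rw [mul_assoc]; gcongr; nlinarith [sq_nonneg ‖R (S k)‖]
      rw [hcM] at h4
      nlinarith
    refine hb.trans_lt ?_
    rw [Real.sqrt_lt' one_pos]
    linarith
  · have hWA : ∀ k, W k - A k = P (Z (R (S k)) - A (adjoint A (Z (R (S k))))) := fun k => by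
      have : A k = P (A (R (S k) + adjoint A (Z (R (S k))))) := by rw [vR1, vX]
      rw [this, vW, ← map_sub, map_add]
      congr 1
      abel
    have hAT : ∀ h, adjoint A (P h) = T (adjoint A h) := fun h => by rw [← vX' h, vT2]
    have hD : (1 : K →L[ℂ] K) - (adjoint A).comp W = S * R * S := by
      ext k
      have e : T (R (S k) + adjoint A (Z (R (S k)))) = k := by rw [vR1, vT2]
      have : k - adjoint A (W k) = S (R (S k)) := by
        rw [vW, hAT]
        nth_rewrite 1 [← e]
        rw [← map_sub, ← vT2 (S (R (S k))), vS, map_add]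
        congr 1
        abel
      simpa using this
    have hI : Ring.inverse ((1 : K →L[ℂ] K) - (adjoint A).comp W)
        = T * (1 + (adjoint A).comp Z) * T := by
      rw [hD]
      generalize 1 + (adjoint A).comp Z = G at hR1 hR2
      apply mob_inverse_eq
      · rw [show S * R * S * (T * G * T) = S * R * (S * T) * G * T by simp only [mul_assoc], hT1,
          mul_one, mul_assoc S, hR2, mul_one, hT1]
      · rw [show T * G * T * (S * R * S) = T * G * (T * S) * R * S by simp only [mul_assoc], hT2,
          mul_one, mul_assoc T, hR1, mul_one, hT2]
    have hRG : ∀ k, R (k + adjoint A (Z k)) = k := fun k => by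
      simpa using DFunLike.congr_fun hR2 k
    ext k
    rw [mobiusEtaInv, hI]
    have : P (W (T (k + adjoint A (Z k))) - A (T (k + adjoint A (Z k)))) = Z k := by
      rw [hWA, vT1, hRG, vP]
    simpa [vT2] using this

end helpers

/-- Let `A` lie in the open unit ball `B` of `L(K,H)`, let
`P = (I - AA*)^{-1/2}` (positive, with `P²` the inverse of `I - AA*`) and
`S = (I - A*A)^{1/2}` (positive, with `S² = I - A*A`).  Then
`η(Z) = (I - AA*)^{-1/2}(Z + A)(I + A*Z)^{-1}(I - A*A)^{1/2}` maps `B` into `B`, and it is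
invertible there with inverse `Z ↦ (I - AA*)^{-1/2}(Z - A)(I - A*Z)^{-1}(I - A*A)^{1/2}`. -/
theorem mobiusEta_maps_ball_and_inverse
    {H K : Type*} [NormedAddCommGroup H] [InnerProductSpace ℂ H] [CompleteSpace H]
    [NormedAddCommGroup K] [InnerProductSpace ℂ K] [CompleteSpace K]
    (A : K →L[ℂ] H) (hA : ‖A‖ < 1)
    (P : H →L[ℂ] H) (hP : P.IsPositive)
    (hP₁ : (P * P) * ((1 : H →L[ℂ] H) - A.comp (adjoint A)) = 1)
    (hP₂ : ((1 : H →L[ℂ] H) - A.comp (adjoint A)) * (P * P) = 1)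
    (S : K →L[ℂ] K) (hS : S.IsPositive)
    (hSsq : S * S = (1 : K →L[ℂ] K) - (adjoint A).comp A) :
    ∀ Z : K →L[ℂ] H, ‖Z‖ < 1 →
      ‖mobiusEta A P S Z‖ < 1 ∧
      mobiusEtaInv A P S (mobiusEta A P S Z) = Z ∧
      mobiusEta A P S (mobiusEtaInv A P S Z) = Z := by
  intro Z hZ
  obtain ⟨h1, h2⟩ := mob_main A hA P hP hP₁ S hS hSsq Z hZ
  refine ⟨h1, h2, ?_⟩
  have h3 := (mob_main (-A) (by simpa using hA) P hP (by simpa using hP₁) S hS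
    (by simpa using hSsq) Z hZ).2
  have e1 : ∀ Y, mobiusEta (-A) P S Y = mobiusEtaInv A P S Y := fun Y => by
    simp [mobiusEta, mobiusEtaInv, sub_eq_add_neg]
  have e2 : ∀ Y, mobiusEtaInv (-A) P S Y = mobiusEta A P S Y := fun Y => by
    simp [mobiusEta, mobiusEtaInv, sub_eq_add_neg]
  rwa [e1, e2] at h3
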